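/- For n ≥ 2, p ∈ (0,1) and all t > 0, the number Y of isolated vertices in G(n,p) satisfies the right tail bound P((Y-μ)/σ ≥ t) ≤ inf_{θ ≥ 0} exp(-θt + H(θ)). -/

import Mathlib

open MeasureTheory ProbabilityTheory Real Finset

noncomputable section

namespace ErdosRenyiIsolated

/-- Index set for the potential edges of a graph on `Fin n`. -/
abbrev EdgeIdx (n : ℕ) := {e : Fin n × Fin n // e.1 < e.2}

/-- Adjacency relation of the random graph encoded by `ω` : `u` and `v` are adjacent
if the corresponding edge indicator is `true`. -/
def adj {n : ℕ} (ω : EdgeIdx n → Bool) (u v : Fin n) : Prop :=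
  if h : u < v then ω ⟨(u, v), h⟩ = true
  else if h' : v < u then ω ⟨(v, u), h'⟩ = true
  else False

instance {n : ℕ} (ω : EdgeIdx n → Bool) (u v : Fin n) : Decidable (adj ω u v) := by
  unfold adj
  split
  · exact inferInstance
  · split
    · exact inferInstance
    · exact inferInstance

/-- Degree of vertex `v` in the graph encoded by `ω`. -/
def deg {n : ℕ} (ω : EdgeIdx n → Bool) (v : Fin n) : ℕ :=
  (Finset.univ.filter fun w => adj ω v w).card

/-- The number of isolated vertices of the graph encoded by `ω`. -/
def isolCount {n : ℕ} (ω : EdgeIdx n → Bool) : ℕ :=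
  (Finset.univ.filter fun v => deg ω v = 0).card

/-- The Bernoulli(p) measure on `Bool`. -/
def bern (p : ℝ) : Measure Bool :=
  ENNReal.ofReal p • Measure.dirac true + ENNReal.ofReal (1 - p) • Measure.dirac false

instance (p : ℝ) : IsFiniteMeasure (bern p) := by
  constructor
  have h : bern p Set.univ ≤ ENNReal.ofReal p + ENNReal.ofReal (1 - p) := by
    simp [bern]
  exact lt_of_le_of_lt h (ENNReal.add_lt_top.mpr ⟨ENNReal.ofReal_lt_top, ENNReal.ofReal_lt_top⟩)

/-- The Erdős–Rényi random graph measure `G(n,p)`: the edge indicators are i.i.d.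
Bernoulli(p). -/
def gnp (n : ℕ) (p : ℝ) : Measure (EdgeIdx n → Bool) :=
  Measure.pi fun _ => bern p

/-- The Erdős–Rényi measure together with an independent uniformly chosen vertex. -/
def gnpV (n : ℕ) (p : ℝ) : Measure ((EdgeIdx n → Bool) × Fin n) :=
  (gnp n p).prod (uniformOn (Set.univ : Set (Fin n)))

/-- Adjacency in the graph obtained by deleting all edges incident to `v'`. -/
def adjDel {n : ℕ} (ω : EdgeIdx n → Bool) (v' u v : Fin n) : Prop :=
  adj ω u v ∧ u ≠ v' ∧ v ≠ v'

instance {n : ℕ} (ω : EdgeIdx n → Bool) (v' u v : Fin n) : Decidable (adjDel ω v' u v) := by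
  unfold adjDel; exact inferInstance

/-- Degree of `v` in the graph `ω` with all edges incident to `v'` deleted. -/
def degDel {n : ℕ} (ω : EdgeIdx n → Bool) (v' v : Fin n) : ℕ :=
  (Finset.univ.filter fun w => adjDel ω v' v w).card

/-- Number of isolated vertices in the graph `ω` with all edges incident to `v'` deleted. -/
def isolCountDel {n : ℕ} (ω : EdgeIdx n → Bool) (v' : Fin n) : ℕ :=
  (Finset.univ.filter fun v => degDel ω v' v = 0).card

section Bernoulli

variable {ι : Type*} [Fintype ι]

/-- The probability of the configuration `ω` of independent Bernoulli(p) indicators. -/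
def weight (p : ℝ) (ω : ι → Bool) : ℝ := ∏ e, if ω e then p else 1 - p

/-- The expectation of `f` under independent Bernoulli(p) indicators. -/
def expect [DecidableEq ι] (p : ℝ) (f : (ι → Bool) → ℝ) : ℝ := ∑ ω, weight p ω * f ω

lemma weight_nonneg {p : ℝ} (hp : p ∈ Set.Ioo (0 : ℝ) 1) (ω : ι → Bool) : 0 ≤ weight p ω := by
  refine Finset.prod_nonneg fun e _ => ?_
  split_ifs <;> linarith [hp.1, hp.2]

variable [DecidableEq ι]

/-- The number of indicators in `S` that are on. -/
def onCount (S : Finset ι) (ω : ι → Bool) : ℕ := (S.filter fun e => ω e = true).card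

/-- `ω` with all the indicators in `S` switched off. -/
def zeroOn (S : Finset ι) (ω : ι → Bool) : ι → Bool := fun e => if e ∈ S then false else ω e

lemma expect_prod (p : ℝ) (h : ι → Bool → ℝ) :
    expect p (fun ω => ∏ e, h e (ω e)) = ∏ e, (p * h e true + (1 - p) * h e false) := by
  have := Finset.prod_univ_sum (fun _ : ι => (Finset.univ : Finset Bool))
    (fun e b => (if b then p else 1 - p) * h e b)
  simp only [Fintype.piFinset_univ, Fintype.sum_bool, if_true, Bool.false_eq_true, if_false] at this
  rw [this, expect]
  exact Finset.sum_congr rfl fun ω _ => by rw [weight, ← Finset.prod_mul_distrib]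

lemma expect_one (p : ℝ) : expect (ι := ι) p (fun _ => 1) = 1 := by
  simpa using expect_prod (ι := ι) p (fun _ _ => 1)

lemma expect_add (p : ℝ) (f g : (ι → Bool) → ℝ) :
    expect p (fun ω => f ω + g ω) = expect p f + expect p g := by
  simp only [expect, mul_add, Finset.sum_add_distrib]

lemma expect_sub (p : ℝ) (f g : (ι → Bool) → ℝ) :
    expect p (fun ω => f ω - g ω) = expect p f - expect p g := by
  simp only [expect, mul_sub, Finset.sum_sub_distrib]

lemma expect_const_mul (p c : ℝ) (f : (ι → Bool) → ℝ) :
    expect p (fun ω => c * f ω) = c * expect p f := by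
  simp only [expect, Finset.mul_sum, mul_left_comm]

lemma expect_sum {κ : Type*} (p : ℝ) (s : Finset κ) (f : κ → (ι → Bool) → ℝ) :
    expect p (fun ω => ∑ v ∈ s, f v ω) = ∑ v ∈ s, expect p (f v) := by
  simp only [expect, Finset.mul_sum]
  exact Finset.sum_comm

lemma expect_mono {p : ℝ} (hp : p ∈ Set.Ioo (0 : ℝ) 1) {f g : (ι → Bool) → ℝ}
    (h : ∀ ω, f ω ≤ g ω) : expect p f ≤ expect p g :=
  Finset.sum_le_sum fun ω _ => mul_le_mul_of_nonneg_left (h ω) (weight_nonneg hp ω)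

lemma hasDerivAt_expect (p : ℝ) {f g : ℝ → (ι → Bool) → ℝ} {s : ℝ}
    (h : ∀ ω, HasDerivAt (fun s => f s ω) (g s ω) s) :
    HasDerivAt (fun s => expect p (f s)) (expect p (g s)) s :=
  HasDerivAt.fun_sum fun ω _ => (h ω).const_mul _

lemma hasDerivAt_expect_exp_mul (p : ℝ) (X : (ι → Bool) → ℝ) (s : ℝ) :
    HasDerivAt (fun s => expect p fun ω => Real.exp (s * X ω))
      (expect p fun ω => X ω * Real.exp (s * X ω)) s :=
  hasDerivAt_expect p (f := fun s ω => Real.exp (s * X ω))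
    (g := fun s ω => X ω * Real.exp (s * X ω)) fun ω => by
    simpa [mul_comm] using ((hasDerivAt_id s).mul_const (X ω)).exp

/-- Harris' inequality for an antitone and a monotone function. -/
lemma expect_mul_le_of_antitone {p : ℝ} (hp : p ∈ Set.Ioo (0 : ℝ) 1) {f g : (ι → Bool) → ℝ}
    (hf : Antitone f) (hg : Monotone g) (hg₀ : ∀ ω, 0 ≤ g ω) :
    expect p (fun ω => f ω * g ω) ≤ expect p f * expect p g := by
  have hle : ∀ ω, f ω ≤ f ⊥ := fun ω => hf bot_le
  have key := fkg (fun ω => f ⊥ - f ω) g (weight (ι := ι) p) (fun ω => weight_nonneg hp ω)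
    (fun ω => sub_nonneg.2 (hle ω)) hg₀ (fun a b hab => sub_le_sub_left (hf hab) _) hg
    (fun a b => by
      simp only [weight, ← Finset.prod_mul_distrib]
      refine le_of_eq (Finset.prod_congr rfl fun e _ => ?_)
      rw [Pi.inf_apply, Pi.sup_apply]
      cases a e <;> cases b e <;> simp [mul_comm])
  change expect p (fun ω => f ⊥ - f ω) * expect p g
    ≤ (∑ ω, weight p ω) * expect p (fun ω => (f ⊥ - f ω) * g ω) at key
  have h1 : ∑ ω : ι → Bool, weight p ω = 1 := by simpa [expect] using expect_one (ι := ι) p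
  have h2 : expect p (fun ω => f ⊥ - f ω) = f ⊥ - expect p f := by
    have := expect_const_mul (ι := ι) p (f ⊥) (fun _ => 1)
    simp only [expect_one, mul_one] at this
    rw [expect_sub, this]
  have h3 : expect p (fun ω => (f ⊥ - f ω) * g ω)
      = f ⊥ * expect p g - expect p (fun ω => f ω * g ω) := by
    simp only [sub_mul]
    rw [expect_sub, expect_const_mul]
  rw [h1, h2, h3] at key
  linarith

omit [Fintype ι] [DecidableEq ι] in
lemma onCount_mono (S : Finset ι) {ω ω' : ι → Bool} (h : ω ≤ ω') :
    onCount S ω ≤ onCount S ω' :=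
  Finset.card_le_card (Finset.monotone_filter_right _ fun e _ he =>
    Bool.eq_true_of_true_le (he ▸ h e))

lemma expect_exp_onCount (p : ℝ) (S : Finset ι) (s : ℝ) :
    expect p (fun ω => Real.exp (s * onCount S ω)) = (p * Real.exp s + 1 - p) ^ S.card := by
  have := expect_prod p (fun (e : ι) b => if e ∈ S then (if b then Real.exp s else 1) else 1)
  convert! this using 1
  · congr 1
    ext ω
    rw [Finset.prod_ite_mem, Finset.univ_inter, Finset.prod_ite, mul_comm s, Real.exp_nat_mul]
    simp [onCount]
  · rw [← Finset.prod_const, ← Finset.univ_inter S, ← Finset.prod_ite_mem]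
    refine Finset.prod_congr rfl fun e _ => ?_
    by_cases he : e ∈ S
    · simp [he, add_sub_assoc]
    · simp [he]

lemma expect_onCount_mul_exp (p : ℝ) (S : Finset ι) (s : ℝ) :
    expect p (fun ω => onCount S ω * Real.exp (s * onCount S ω))
      = S.card * (p * Real.exp s + 1 - p) ^ (S.card - 1) * (p * Real.exp s) := by
  have h1 := hasDerivAt_expect_exp_mul p (fun ω => (onCount S ω : ℝ)) s
  simp only [expect_exp_onCount] at h1
  exact h1.unique ((((Real.hasDerivAt_exp s).const_mul p).add_const 1 |>.sub_const p).fun_pow _)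

lemma expect_size_bias_factor (p : ℝ) (S : Finset ι) (s : ℝ) (hS : 1 ≤ S.card) :
    expect p (fun ω => (1 + onCount S ω) * (1 + Real.exp (s * (1 + onCount S ω))))
      = Real.exp s * (p * Real.exp s + 1 - p) ^ (S.card - 1)
        * ((S.card + 1) * p * Real.exp s + 1 - p) + S.card * p + 1 := by
  have h0 := expect_onCount_mul_exp p S 0
  have h1 := expect_exp_onCount p S s
  have h2 := expect_onCount_mul_exp p S s
  simp only [zero_mul, Real.exp_zero, mul_one, add_sub_cancel_left, one_pow] at h0
  have : (fun ω : ι → Bool => (1 + (onCount S ω : ℝ)) * (1 + Real.exp (s * (1 + onCount S ω))))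
      = fun ω => (1 + onCount S ω) + (Real.exp s * Real.exp (s * onCount S ω)
        + Real.exp s * (onCount S ω * Real.exp (s * onCount S ω))) := by
    ext ω
    rw [mul_add s, Real.exp_add]
    ring_nf
  rw [this, expect_add, expect_add, expect_add, expect_const_mul, expect_const_mul, expect_one,
    h0, h1, h2]
  obtain ⟨k, hk⟩ := Nat.exists_eq_add_of_le' hS
  rw [hk, Nat.add_sub_cancel]
  push_cast
  ring

lemma expect_onCount_eq_zero (p : ℝ) (S : Finset ι) (g : (ι → Bool) → ℝ) :
    expect p (fun ω => if onCount S ω = 0 then g ω else 0)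
      = (1 - p) ^ S.card * expect p (fun ω => g (zeroOn S ω)) := by
  let E := Equiv.piEquivPiSubtypeProd (fun e => e ∈ S) (fun _ => Bool)
  have hW : ∀ a b, weight p (E.symm (a, b)) = weight p a * weight p b := fun a b => by
    rw [weight, ← Fintype.prod_subtype_mul_prod_subtype (fun e => e ∈ S)]
    congr 1 <;> refine Finset.prod_congr (by ext; simp) fun e _ => ?_ <;>
      simp [E, Equiv.piEquivPiSubtypeProd_symm_apply, e.2]
  have hC : ∀ a b, zeroOn S (E.symm (a, b)) = E.symm (fun _ => false, b) := fun a b => by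
    ext e
    by_cases he : e ∈ S <;> simp [zeroOn, E, Equiv.piEquivPiSubtypeProd_symm_apply, he]
  have hN : ∀ a b, onCount S (E.symm (a, b)) = 0 ↔ a = fun _ => false := fun a b => by
    rw [onCount, Finset.card_eq_zero, Finset.filter_eq_empty_iff, funext_iff, Subtype.forall]
    refine forall₂_congr fun e he => ?_
    simp [E, Equiv.piEquivPiSubtypeProd_symm_apply, he]
  have hsum : ∀ f : (ι → Bool) → ℝ, expect p f
      = ∑ a, ∑ b, weight p a * weight p b * f (E.symm (a, b)) := fun f => by
    rw [expect, ← E.symm.sum_comp, Fintype.sum_prod_type]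
    simp only [hW]
  have h1 : ∑ a : {e // e ∈ S} → Bool, weight p a = 1 := by
    simpa [expect] using expect_one (ι := {e // e ∈ S}) p
  simp only [hsum, hC, hN]
  rw [Finset.sum_eq_single (fun _ => false) (fun a _ ha => by simp [ha]) (by simp)]
  simp only [mul_assoc, ← Finset.mul_sum, ← Finset.sum_mul, h1, one_mul, if_true]
  simp [weight]

end Bernoulli

section Graph

variable {n : ℕ}

lemma adj_iff (ω : EdgeIdx n → Bool) (u v : Fin n) :
    adj ω u v ↔ (∃ h : u < v, ω ⟨(u, v), h⟩ = true) ∨ ∃ h : v < u, ω ⟨(v, u), h⟩ = true := by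
  unfold adj
  split_ifs with h h'
  · simp [h, h.not_gt]
  · simp [h, h']
  · simp [h, h']

lemma adj_comm (ω : EdgeIdx n → Bool) (u v : Fin n) : adj ω u v ↔ adj ω v u := by
  rw [adj_iff, adj_iff, or_comm]

lemma adj_mono {ω ω' : EdgeIdx n → Bool} (h : ω ≤ ω') {u v : Fin n} (huv : adj ω u v) :
    adj ω' u v := by
  rw [adj_iff] at huv ⊢
  exact huv.imp (fun ⟨hlt, ht⟩ => ⟨hlt, Bool.eq_true_of_true_le (ht ▸ h _)⟩)
    (fun ⟨hlt, ht⟩ => ⟨hlt, Bool.eq_true_of_true_le (ht ▸ h _)⟩)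

/-- The potential edges with endpoint `v`. -/
def incident (v : Fin n) : Finset (EdgeIdx n) :=
  Finset.univ.filter fun e => e.1.1 = v ∨ e.1.2 = v

lemma deg_eq_onCount (ω : EdgeIdx n → Bool) (v : Fin n) : deg ω v = onCount (incident v) ω := by
  refine (Finset.card_bij (fun e _ => if e.1.1 = v then e.1.2 else e.1.1) ?_ ?_ ?_).symm
  · rintro ⟨⟨a, b⟩, hab⟩ he
    simp only [incident, Finset.mem_filter, Finset.mem_univ, true_and] at he ⊢
    obtain ⟨rfl | rfl, ht⟩ := he
    · exact (adj_iff _ _ _).2 (Or.inl (by simpa using ⟨hab, ht⟩))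
    · exact (adj_iff _ _ _).2 (Or.inr (by simpa [hab.ne] using ⟨hab, ht⟩))
  · rintro ⟨⟨a, b⟩, hab⟩ he ⟨⟨c, d⟩, hcd⟩ he' h
    simp only [incident, Finset.mem_filter, Finset.mem_univ, true_and] at he he' h hab hcd
    simp only [Subtype.mk.injEq, Prod.mk.injEq]
    grind
  · intro w hw
    simp only [Finset.mem_filter, Finset.mem_univ, true_and, adj_iff] at hw
    obtain ⟨h, ht⟩ | ⟨h, ht⟩ := hw
    · exact ⟨⟨(v, w), h⟩, by simp [incident, ht], by simp⟩
    · exact ⟨⟨(w, v), h⟩, by simp [incident, ht], by simp [h.ne]⟩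

lemma card_incident (v : Fin n) : (incident v).card = n - 1 := by
  have h : deg (fun _ : EdgeIdx n => true) v = (incident v).card := by
    simp [deg_eq_onCount, onCount]
  have h' : (Finset.univ.filter fun w => adj (fun _ : EdgeIdx n => true) v w)
      = Finset.univ.erase v := by
    ext w
    simp [adj_iff, ← lt_or_lt_iff_ne, or_comm]
  rw [← h, deg, h', Finset.card_erase_of_mem (Finset.mem_univ _), Finset.card_univ,
    Fintype.card_fin]

lemma deg_eq_zero_iff (ω : EdgeIdx n → Bool) (v : Fin n) : deg ω v = 0 ↔ ∀ w, ¬ adj ω v w := by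
  simp [deg, Finset.filter_eq_empty_iff]

lemma adj_zeroOn_incident {ω : EdgeIdx n → Bool} {u v w : Fin n} (h : adj ω u w) (hu : u ≠ v)
    (hw : w ≠ v) : adj (zeroOn (incident v) ω) u w := by
  rw [adj_iff] at h ⊢
  simpa [zeroOn, incident, hu, hw] using h

lemma isolCount_antitone {ω ω' : EdgeIdx n → Bool} (h : ω ≤ ω') : isolCount ω' ≤ isolCount ω := by
  refine Finset.card_le_card (Finset.monotone_filter_right _ fun v _ hv => ?_)
  rw [deg_eq_zero_iff] at hv ⊢
  exact fun w hw => hv w (adj_mono h hw)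

lemma isolCount_zeroOn_incident_le (ω : EdgeIdx n → Bool) (v : Fin n) :
    isolCount (zeroOn (incident v) ω) ≤ isolCount ω + (1 + deg ω v) := by
  rw [isolCount, isolCount, deg, ← Finset.card_singleton v]
  refine (Finset.card_le_card (t := (Finset.univ.filter fun v => deg ω v = 0)
    ∪ ({v} ∪ Finset.univ.filter fun w => adj ω v w)) fun u hu => ?_).trans
    ((Finset.card_union_le _ _).trans (Nat.add_le_add_left (Finset.card_union_le _ _) _))
  simp only [Finset.mem_filter, Finset.mem_univ, true_and, Finset.mem_union,
    Finset.mem_singleton, deg_eq_zero_iff] at hu ⊢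
  by_contra! hc
  obtain ⟨⟨w, hw⟩, huv, hadj⟩ := hc
  refine hu w (adj_zeroOn_incident hw huv ?_)
  rintro rfl
  exact hadj ((adj_comm _ _ _).1 hw)

/-- Removing the edges at a uniformly chosen vertex size-biases the number of isolated
vertices. -/
lemma expect_isolCount_mul (p : ℝ) (f : ℝ → ℝ) :
    expect p (fun ω : EdgeIdx n → Bool => isolCount ω * f (isolCount ω))
      = (1 - p) ^ (n - 1) * ∑ v : Fin n, expect p fun ω => f (isolCount (zeroOn (incident v) ω)) := by
  have h : (fun ω : EdgeIdx n → Bool => (isolCount ω : ℝ) * f (isolCount ω))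
      = fun ω => ∑ v : Fin n, if onCount (incident v) ω = 0 then f (isolCount ω) else 0 := by
    ext ω
    rw [← Finset.sum_filter, Finset.sum_const, nsmul_eq_mul]
    simp only [← deg_eq_onCount]
    rfl
  rw [h, expect_sum, Finset.mul_sum]
  refine Finset.sum_congr rfl fun v _ => ?_
  rw [expect_onCount_eq_zero, card_incident]

lemma exp_sub_one_le {x : ℝ} (hx : 0 ≤ x) : Real.exp x - 1 ≤ x * (1 + Real.exp x) / 2 := by
  have hd : ∀ y : ℝ, HasDerivAt (fun y => y * (1 + Real.exp y) / 2 - Real.exp y)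
      ((1 * (1 + Real.exp y) + y * Real.exp y) / 2 - Real.exp y) y := fun y =>
    (((hasDerivAt_id y).mul ((Real.hasDerivAt_exp y).const_add 1)).div_const 2).sub
      (Real.hasDerivAt_exp y)
  have hm : Monotone fun y => y * (1 + Real.exp y) / 2 - Real.exp y := by
    refine monotone_of_hasDerivAt_nonneg hd fun y => ?_
    have h1 := Real.add_one_le_exp (-y)
    have h2 : Real.exp y * Real.exp (-y) = 1 := by rw [← Real.exp_add]; simp
    have h3 := mul_le_mul_of_nonneg_left h1 (Real.exp_pos y).le
    simp only [Pi.zero_apply]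
    nlinarith
  have := hm hx
  simp only [zero_mul, Real.exp_zero, zero_div] at this
  linarith

lemma expect_exp_zeroOn_sub_le {p : ℝ} (hp : p ∈ Set.Ioo (0 : ℝ) 1) (hn : 2 ≤ n) {s : ℝ}
    (hs : 0 ≤ s) (μ : ℝ) (v : Fin n) :
    expect p (fun ω : EdgeIdx n → Bool => Real.exp (s * (isolCount (zeroOn (incident v) ω) - μ)))
        - expect p (fun ω : EdgeIdx n → Bool => Real.exp (s * (isolCount ω - μ)))
      ≤ s / 2 * (expect p (fun ω : EdgeIdx n → Bool => Real.exp (s * (isolCount ω - μ)))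
        * (Real.exp s * (p * Real.exp s + 1 - p) ^ (n - 2) * (n * p * Real.exp s + 1 - p)
          + (n - 1) * p + 1)) := by
  have hfac := expect_size_bias_factor p (incident v) s (by rw [card_incident]; omega)
  rw [card_incident, Nat.sub_sub, Nat.cast_sub (by omega), Nat.cast_one, sub_add_cancel] at hfac
  rw [← hfac, ← expect_sub]
  have harris := expect_mul_le_of_antitone hp
    (f := fun ω : EdgeIdx n → Bool => Real.exp (s * (isolCount ω - μ)))
    (g := fun ω => (1 + onCount (incident v) ω)
      * (1 + Real.exp (s * (1 + onCount (incident v) ω))))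
    (fun a b hab => by
      have : (isolCount b : ℝ) ≤ isolCount a := by exact_mod_cast isolCount_antitone hab
      dsimp only
      gcongr)
    (fun a b hab => by
      have : (onCount (incident v) a : ℝ) ≤ onCount (incident v) b := by
        exact_mod_cast onCount_mono (incident v) hab
      dsimp only
      gcongr)
    (fun ω => by positivity)
  refine le_trans ?_ (mul_le_mul_of_nonneg_left harris (by positivity))
  rw [← expect_const_mul]
  refine expect_mono hp fun ω => ?_
  have hle : (isolCount (zeroOn (incident v) ω) : ℝ)
      ≤ isolCount ω + (1 + onCount (incident v) ω) := by
    have := isolCount_zeroOn_incident_le ω v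
    rw [deg_eq_onCount] at this
    exact_mod_cast this
  have h1 : Real.exp (s * (isolCount (zeroOn (incident v) ω) - μ))
      ≤ Real.exp (s * (isolCount ω - μ)) * Real.exp (s * (1 + onCount (incident v) ω)) := by
    rw [← Real.exp_add]
    refine Real.exp_le_exp.2 ?_
    nlinarith
  have h2 := mul_le_mul_of_nonneg_left
    (exp_sub_one_le (x := s * (1 + onCount (incident v) ω)) (by positivity))
    (Real.exp_pos (s * (isolCount ω - μ))).le
  nlinarith

lemma gnp_real_eq_sum {p : ℝ} (hp : p ∈ Set.Ioo (0 : ℝ) 1) (A : Finset (EdgeIdx n → Bool)) :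
    ((gnp n p) (A : Set (EdgeIdx n → Bool))).toReal = ∑ ω ∈ A, weight p ω := by
  have : IsFiniteMeasure (gnp n p) := by unfold gnp; infer_instance
  rw [← measureReal_def, ← sum_measureReal_singleton]
  refine Finset.sum_congr rfl fun ω _ => ?_
  rw [measureReal_def, gnp, Measure.pi_singleton, ENNReal.toReal_prod, weight]
  refine Finset.prod_congr rfl fun e _ => ?_
  cases ω e <;> simp [bern, hp.1.le, hp.2.le]

lemma gnp_le_expect_exp {p : ℝ} (hp : p ∈ Set.Ioo (0 : ℝ) 1) (X : (EdgeIdx n → Bool) → ℝ)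
    (t : ℝ) {θ : ℝ} (hθ : 0 ≤ θ) :
    ((gnp n p) {ω | t ≤ X ω}).toReal ≤ Real.exp (-θ * t) * expect p fun ω => Real.exp (θ * X ω) := by
  have hA : {ω | t ≤ X ω} = ((Finset.univ.filter fun ω => t ≤ X ω : Finset _) : Set _) := by
    ext; simp
  rw [hA, gnp_real_eq_sum hp, Finset.sum_filter, ← expect_const_mul]
  refine Finset.sum_le_sum fun ω _ => ?_
  split_ifs with h
  · refine le_mul_of_one_le_right (weight_nonneg hp ω) ?_
    dsimp only
    rw [← Real.exp_add]
    exact Real.one_le_exp (by nlinarith)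
  · exact mul_nonneg (weight_nonneg hp ω) (by positivity)

/-- Integrated form of a differential inequality `m' ≤ H' m`. -/
lemma le_exp_of_hasDerivAt_le {m m' H H' : ℝ → ℝ} (hm : ∀ x, HasDerivAt m (m' x) x)
    (hH : ∀ x, HasDerivAt H (H' x) x) (hle : ∀ x, 0 ≤ x → m' x ≤ H' x * m x)
    (hm₀ : m 0 = 1) (hH₀ : H 0 = 0) {θ : ℝ} (hθ : 0 ≤ θ) : m θ ≤ Real.exp (H θ) := by
  have hd : ∀ x, HasDerivAt (fun x => m x * Real.exp (-H x))
      (m' x * Real.exp (-H x) + m x * (Real.exp (-H x) * -H' x)) x := fun x =>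
    (hm x).mul (hH x).neg.exp
  have hanti : AntitoneOn (fun x => m x * Real.exp (-H x)) (Set.Ici 0) := by
    refine antitoneOn_of_deriv_nonpos (convex_Ici 0)
      (fun x _ => (hd x).continuousAt.continuousWithinAt)
      (fun x _ => (hd x).differentiableAt.differentiableWithinAt) fun x hx => ?_
    rw [interior_Ici] at hx
    rw [(hd x).deriv]
    have := mul_le_mul_of_nonneg_right (hle x (le_of_lt hx)) (Real.exp_pos (-H x)).le
    linarith
  have := hanti (Set.self_mem_Ici) (Set.mem_Ici.2 hθ) hθ
  simp only [hm₀, hH₀, neg_zero, Real.exp_zero, mul_one] at this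
  rwa [Real.exp_neg, ← div_eq_mul_inv, div_le_one (Real.exp_pos _)] at this

/-- The differential inequality satisfied by the moment generating function of the normalized
number of isolated vertices. -/
lemma expect_mul_exp_le {p : ℝ} (hp : p ∈ Set.Ioo (0 : ℝ) 1) (hn : 2 ≤ n) {μ σ g θ : ℝ}
    (hμ : μ = n * (1 - p) ^ (n - 1)) (hσ : 0 < σ)
    (hg : g = Real.exp (θ / σ) * (p * Real.exp (θ / σ) + 1 - p) ^ (n - 2)
      * (n * p * Real.exp (θ / σ) + 1 - p) + (n - 1) * p + 1) (hθ : 0 ≤ θ) :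
    (expect p fun ω : EdgeIdx n → Bool =>
        ((isolCount ω : ℝ) - μ) / σ * Real.exp (θ * (((isolCount ω : ℝ) - μ) / σ)))
      ≤ μ / (2 * σ ^ 2) * (θ * g) * expect p fun ω : EdgeIdx n → Bool =>
        Real.exp (θ * (((isolCount ω : ℝ) - μ) / σ)) := by
  let X : (EdgeIdx n → Bool) → ℝ := fun ω => ((isolCount ω : ℝ) - μ) / σ
  have hq : 0 < 1 - p := sub_pos.2 hp.2
  change (expect p fun ω => X ω * Real.exp (θ * X ω))
    ≤ μ / (2 * σ ^ 2) * (θ * g) * expect p fun ω => Real.exp (θ * X ω)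
  have hX : ∀ ω, θ * X ω = θ / σ * (isolCount ω - μ) := fun ω => by
    simp only [X]
    ring
  have hsb := expect_isolCount_mul (n := n) p fun y => Real.exp (θ / σ * (y - μ))
  have hsub := expect_sub p
    (fun ω : EdgeIdx n → Bool => isolCount ω * Real.exp (θ / σ * (isolCount ω - μ)))
    (fun ω => μ * Real.exp (θ / σ * (isolCount ω - μ)))
  have hsum := Finset.sum_le_sum fun (v : Fin n) (_ : v ∈ Finset.univ) =>
    expect_exp_zeroOn_sub_le hp hn (div_nonneg hθ hσ.le) μ v
  rw [Finset.sum_sub_distrib, Finset.sum_const, Finset.sum_const, Finset.card_univ,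
    Fintype.card_fin, nsmul_eq_mul, nsmul_eq_mul, ← hg] at hsum
  have hscale : (expect p fun ω => X ω * Real.exp (θ * X ω))
      = 1 / σ * expect p fun ω : EdgeIdx n → Bool =>
        isolCount ω * Real.exp (θ / σ * (isolCount ω - μ))
          - μ * Real.exp (θ / σ * (isolCount ω - μ)) := by
    rw [← expect_const_mul]
    congr 1
    ext ω
    rw [hX]
    simp only [X]
    ring
  rw [hscale, hsub, hsb, expect_const_mul]
  simp only [hX]
  generalize (expect p fun ω : EdgeIdx n → Bool => Real.exp (θ / σ * (isolCount ω - μ))) = M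
    at hsum ⊢
  generalize (∑ v : Fin n, expect p fun ω : EdgeIdx n → Bool =>
    Real.exp (θ / σ * (isolCount (zeroOn (incident v) ω) - μ))) = T at hsum ⊢
  rw [hμ]
  calc
    _ = 1 / σ * (1 - p) ^ (n - 1) * (T - n * M) := by ring
    _ ≤ 1 / σ * (1 - p) ^ (n - 1) * (n * (θ / σ / 2 * (M * g))) :=
      mul_le_mul_of_nonneg_left hsum (by positivity)
    _ = _ := by field_simp

end Graph

/-- right tail bound for the number of isolated vertices. -/
theorem right_tail_bound (n : ℕ) (hn : 2 ≤ n) (p : ℝ) (hp : p ∈ Set.Ioo (0 : ℝ) 1)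
    (μ σ : ℝ) (hμ : μ = (n : ℝ) * (1 - p) ^ (n - 1))
    (hσ : σ = Real.sqrt ((n : ℝ) * (1 - p) ^ (n - 1)
      * (1 + (n : ℝ) * p * (1 - p) ^ (n - 2) - (1 - p) ^ (n - 2))))
    (γ : ℝ → ℝ)
    (hγ : ∀ s, γ s = Real.exp s * (p * Real.exp s + 1 - p) ^ (n - 2)
      * ((n : ℝ) * p * Real.exp s + 1 - p) + ((n : ℝ) - 1) * p + 1)
    (H : ℝ → ℝ) (hH : ∀ θ, H θ = μ / (2 * σ ^ 2) * ∫ s in (0 : ℝ)..θ, s * γ (s / σ)) :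
    ∀ t : ℝ, 0 < t →
      ((gnp n p) {ω | t ≤ ((isolCount ω : ℝ) - μ) / σ}).toReal
        ≤ ⨅ θ : {x : ℝ // 0 ≤ x}, Real.exp (-(θ : ℝ) * t + H θ) := by
  intro t _
  have hp0 := hp.1
  have hq : 0 < 1 - p := sub_pos.2 hp.2
  have hn0 : (0 : ℝ) < n := by exact_mod_cast (by omega : 0 < n)
  have hσ0 : 0 < σ := by
    have h1 : (1 - p) ^ (n - 2) ≤ 1 := pow_le_one₀ hq.le (by linarith)
    have h2 : 0 < (n : ℝ) * p * (1 - p) ^ (n - 2) := by positivity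
    rw [hσ]
    exact Real.sqrt_pos.2 (mul_pos (by positivity) (by linarith))
  have hHd : ∀ θ, HasDerivAt H (μ / (2 * σ ^ 2) * (θ * γ (θ / σ))) θ := fun θ => by
    have hγc : Continuous γ := by
      rw [funext hγ]
      fun_prop
    have hc : Continuous fun s => s * γ (s / σ) := by fun_prop
    rw [funext hH]
    exact (intervalIntegral.integral_hasDerivAt_right (hc.intervalIntegrable _ _)
      hc.stronglyMeasurable.stronglyMeasurableAtFilter hc.continuousAt).const_mul _
  let X : (EdgeIdx n → Bool) → ℝ := fun ω => ((isolCount ω : ℝ) - μ) / σ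
  have hmd : ∀ θ, HasDerivAt (fun θ => expect p fun ω => Real.exp (θ * X ω))
      (expect p fun ω => X ω * Real.exp (θ * X ω)) θ :=
    hasDerivAt_expect_exp_mul p X
  have hle : ∀ θ, 0 ≤ θ → (expect p fun ω => X ω * Real.exp (θ * X ω))
      ≤ μ / (2 * σ ^ 2) * (θ * γ (θ / σ)) * expect p fun ω => Real.exp (θ * X ω) :=
    fun θ hθ => expect_mul_exp_le hp hn hμ hσ0 (hγ (θ / σ)) hθ
  have : Nonempty {x : ℝ // 0 ≤ x} := ⟨⟨0, le_rfl⟩⟩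
  refine le_ciInf fun θ => ?_
  rw [Real.exp_add]
  have hmgf : (expect p fun ω => Real.exp (θ * X ω)) ≤ Real.exp (H θ) :=
    le_exp_of_hasDerivAt_le (m := fun θ => expect p fun ω => Real.exp (θ * X ω))
      (m' := fun θ => expect p fun ω => X ω * Real.exp (θ * X ω))
      (H' := fun θ => μ / (2 * σ ^ 2) * (θ * γ (θ / σ))) hmd hHd hle
      (by simp [expect_one]) (by simp [hH]) θ.2
  calc
    _ ≤ Real.exp (-(θ : ℝ) * t) * expect p fun ω => Real.exp (θ * X ω) :=
      gnp_le_expect_exp hp X t θ.2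
    _ ≤ _ := mul_le_mul_of_nonneg_left hmgf (Real.exp_pos _).le

end ErdosRenyiIsolated
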